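/- arXiv:2501.00831 — 2 statements merged into one kernel-verified Lean document; each statement's English description precedes it below -/
import Mathlib

section
/- Let g : K^n → K be weakly hazard-free with g(u,…,u) = u, let 1 ≤ k ≤ n, and suppose that every y ∈ K^n with y_1 = … = y_k = u satisfies g(y) = u (so the first k coordinates form a certificate for the all-u input). For a ∈ K^k define g_a : K^{n−k} → K by g_a(z) = g(a, z). Then for every a ∈ K^k: (1) g_a is weakly hazard-free; (2) cc_u^{(u)}(g_a) ≤ cc_u^{(u)}(g); (3) cc_u^{(0)}(g_a) is either 0 or at most cc_u^{(0)}(g) − 1; (4) cc_u^{(1)}(g_a) is either 0 or at most cc_u^{(1)}(g) − 1. -/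
/-- Kleene's three-valued domain: `none` is the unstable value `u`,
`some b` is a stable Boolean value. -/
abbrev K : Type := Option Bool

namespace HF

variable {ι : Type} [Fintype ι] [DecidableEq ι]

/-- Instability order on inputs: `Below x y` means `x ≤ y`, i.e. each coordinate of `x`
is either `u` or equal to the corresponding coordinate of `y`. -/
def Below (x y : ι → K) : Prop := ∀ i, x i = none ∨ x i = y i

/-- `x` is strictly below `y` in the instability order. -/
def StrictBelow (x y : ι → K) : Prop := Below x y ∧ x ≠ y

/-- `y` is strictly above `x` in the instability order. -/
def StrictAbove (y x : ι → K) : Prop := Below x y ∧ y ≠ x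

/-- `x : ι → Bool` is a resolution of `y : ι → K`. -/
def Resolves (y : ι → K) (x : ι → Bool) : Prop := ∀ i, y i = none ∨ y i = some (x i)

instance (y : ι → K) : DecidablePred (Resolves y) := fun x => by
  unfold Resolves; infer_instance

/-- The hazard-free extension of a Boolean function `f`. -/
def hfExt (f : (ι → Bool) → Bool) (y : ι → K) : K :=
  if ∀ x, Resolves y x → f x = true then some true
  else if ∀ x, Resolves y x → f x = false then some false
  else none

/-- Number of unstable (`u`) coordinates of an input. -/
def numU (x : ι → K) : ℕ := (Finset.univ.filter fun i => x i = none).card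

/-- Ternary (hazard-free) decision trees: leaves are labeled by values in `K`,
internal nodes query a position and have children for responses `0`, `u`, `1`. -/
inductive TDT (ι : Type) : Type where
  | leaf : K → TDT ι
  | node : ι → TDT ι → TDT ι → TDT ι → TDT ι

namespace TDT

/-- Evaluate a ternary decision tree on an input in `K^ι`. -/
def eval : TDT ι → (ι → K) → K
  | .leaf b, _ => b
  | .node i t0 tu t1, x =>
    match x i with
    | some false => eval t0 x
    | none => eval tu x
    | some true => eval t1 x

/-- Depth of a ternary decision tree. -/
def depth : TDT ι → ℕ
  | .leaf _ => 0
  | .node _ t0 tu t1 => max (max (depth t0) (depth tu)) (depth t1) + 1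

/-- Size (number of leaves) of a ternary decision tree. -/
def size : TDT ι → ℕ
  | .leaf _ => 1
  | .node _ t0 tu t1 => size t0 + size tu + size t1

end TDT

/-- Boolean decision trees. -/
inductive BDT (ι : Type) : Type where
  | leaf : Bool → BDT ι
  | node : ι → BDT ι → BDT ι → BDT ι

namespace BDT

/-- Evaluate a Boolean decision tree. -/
def eval : BDT ι → (ι → Bool) → Bool
  | .leaf b, _ => b
  | .node i t0 t1, x => if x i then eval t1 x else eval t0 x

/-- Depth of a Boolean decision tree. -/
def depth : BDT ι → ℕ
  | .leaf _ => 0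
  | .node _ t0 t1 => max (depth t0) (depth t1) + 1

/-- Size (number of leaves) of a Boolean decision tree. -/
def size : BDT ι → ℕ
  | .leaf _ => 1
  | .node _ t0 t1 => size t0 + size t1

end BDT

/-- A ternary tree computes (the hazard-free extension of) the Boolean function `f`. -/
def ComputesHF (f : (ι → Bool) → Bool) (T : TDT ι) : Prop := ∀ x, T.eval x = hfExt f x

/-- A ternary tree computes a `K`-valued function `g`. -/
def ComputesT (g : (ι → K) → K) (T : TDT ι) : Prop := ∀ x, T.eval x = g x

/-- A Boolean tree computes the Boolean function `f`. -/
def ComputesB (f : (ι → Bool) → Bool) (T : BDT ι) : Prop := ∀ x, T.eval x = f x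

/-- A `k`-bit hazard-free decision tree for `f`: correct on all inputs with at most
`k` unstable coordinates. -/
def KComputes (k : ℕ) (f : (ι → Bool) → Bool) (T : TDT ι) : Prop :=
  ∀ x : ι → K, numU x ≤ k → T.eval x = hfExt f x

/-- Minimum depth of a ternary decision tree computing a `K`-valued function. -/
noncomputable def depthT (g : (ι → K) → K) : ℕ :=
  sInf {d | ∃ T : TDT ι, ComputesT g T ∧ T.depth = d}

/-- Hazard-free decision tree depth of a Boolean function. -/
noncomputable def depthU (f : (ι → Bool) → Bool) : ℕ :=
  sInf {d | ∃ T : TDT ι, ComputesHF f T ∧ T.depth = d}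

/-- Hazard-free decision tree size (minimum number of leaves). -/
noncomputable def sizeU (f : (ι → Bool) → Bool) : ℕ :=
  sInf {s | ∃ T : TDT ι, ComputesHF f T ∧ T.size = s}

/-- Boolean decision tree size (minimum number of leaves). -/
noncomputable def sizeB (f : (ι → Bool) → Bool) : ℕ :=
  sInf {s | ∃ T : BDT ι, ComputesB f T ∧ T.size = s}

/-- The multiplexer function `MUX n` on `n` selector bits and `2^n` data bits. -/
def MUX (n : ℕ) (z : (Fin n ⊕ (Fin n → Bool)) → Bool) : Bool :=
  z (Sum.inr fun i => z (Sum.inl i))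

/-- Hazard-free sensitivity of `g` at `x`. -/
noncomputable def sensAt (g : (ι → K) → K) (x : ι → K) : ℕ :=
  Set.ncard {i : ι | ∃ y : ι → K, y i ≠ x i ∧ (∀ j, j ≠ i → y j = x j) ∧ g y ≠ g x}

/-- Hazard-free sensitivity of `g`. -/
noncomputable def sens (g : (ι → K) → K) : ℕ := ⨆ x : ι → K, sensAt g x

/-- Hazard-free sensitivity of `g` restricted to inputs with output value `b`. -/
noncomputable def sensVal (g : (ι → K) → K) (b : K) : ℕ :=
  ⨆ x : {x : ι → K // g x = b}, sensAt g x.1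

/-- Hazard-free block sensitivity of `g` at `x`. -/
noncomputable def bsensAt (g : (ι → K) → K) (x : ι → K) : ℕ :=
  sSup {k : ℕ | ∃ B : Fin k → Finset ι, (∀ j, (B j).Nonempty) ∧
    (∀ j j', j ≠ j' → Disjoint (B j) (B j')) ∧
    ∀ j, ∃ y : ι → K, (∀ i, y i ≠ x i ↔ i ∈ B j) ∧ g y ≠ g x}

/-- Hazard-free block sensitivity of `g`. -/
noncomputable def bsens (g : (ι → K) → K) : ℕ := ⨆ x, bsensAt g x

/-- Hazard-free certificate complexity of `g` at `x`. -/
noncomputable def ccAt (g : (ι → K) → K) (x : ι → K) : ℕ :=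
  sInf {k : ℕ | ∃ S : Finset ι, S.card = k ∧
    ∀ y : ι → K, (∀ i ∈ S, y i = x i) → g y = g x}

/-- Hazard-free certificate complexity of `g`. -/
noncomputable def cc (g : (ι → K) → K) : ℕ := ⨆ x, ccAt g x

/-- Hazard-free certificate complexity of `g` restricted to inputs with output value `b`. -/
noncomputable def ccVal (g : (ι → K) → K) (b : K) : ℕ :=
  ⨆ x : {x : ι → K // g x = b}, ccAt g x.1

/-- Boolean sensitivity of a Boolean function. -/
noncomputable def boolSens (f : (ι → Bool) → Bool) : ℕ :=
  ⨆ x : ι → Bool, Set.ncard {i : ι | f (Function.update x i (!(x i))) ≠ f x}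

/-- `p` is a prime implicant of `f`. -/
def PrimeImplicant (f : (ι → Bool) → Bool) (p : ι → K) : Prop :=
  hfExt f p = some true ∧ ∀ q, StrictBelow q p → hfExt f q ≠ some true

/-- `p` is a prime implicate of `f`. -/
def PrimeImplicate (f : (ι → Bool) → Bool) (p : ι → K) : Prop :=
  hfExt f p = some false ∧ ∀ q, StrictBelow q p → hfExt f q ≠ some false

/-- Size of an implicant/implicate: the number of stable coordinates. -/
noncomputable def isize (p : ι → K) : ℕ := Set.ncard {i : ι | p i ≠ none}

/-- Hamming distance between two inputs in `K^ι`. -/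
noncomputable def hamm (x y : ι → K) : ℕ := Set.ncard {i : ι | x i ≠ y i}

/-- Hazard-free evaluation of a literal (variable and polarity). -/
def litEval (x : ι → K) (l : ι × Bool) : K := if l.2 then x l.1 else (x l.1).map not

/-- Hazard-free evaluation of a term (conjunction of literals). -/
def termEval (t : Finset (ι × Bool)) (x : ι → K) : K :=
  if ∀ l ∈ t, litEval x l = some true then some true
  else if ∃ l ∈ t, litEval x l = some false then some false
  else none

/-- Hazard-free evaluation of a clause (disjunction of literals). -/
def clauseEval (c : Finset (ι × Bool)) (x : ι → K) : K :=
  if ∃ l ∈ c, litEval x l = some true then some true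
  else if ∀ l ∈ c, litEval x l = some false then some false
  else none

/-- Hazard-free evaluation of a DNF formula (a set of terms). -/
def dnfEval (D : Finset (Finset (ι × Bool))) (x : ι → K) : K :=
  if ∃ t ∈ D, termEval t x = some true then some true
  else if ∀ t ∈ D, termEval t x = some false then some false
  else none

/-- Hazard-free evaluation of a CNF formula (a set of clauses). -/
def cnfEval (C : Finset (Finset (ι × Bool))) (x : ι → K) : K :=
  if ∀ c ∈ C, clauseEval c x = some true then some true
  else if ∃ c ∈ C, clauseEval c x = some false then some false
  else none

/-- A function `g : K^ι → K` is weakly hazard-free: it is monotone with respect to the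
instability order, and whenever all points strictly above `x` have the same value `b`
(and some such point exists), `g x = b` as well. -/
def WeaklyHF (g : (ι → K) → K) : Prop :=
  (∀ x y, Below x y → g x = none ∨ g x = g y) ∧
  (∀ x (b : K), (∃ y, StrictAbove y x) → (∀ y, StrictAbove y x → g y = b) → g x = b)

/-- The subcube `C(x)` is monochromatic for `f`. -/
def Mono (f : (ι → Bool) → Bool) (x : ι → K) : Prop :=
  ∀ y z : ι → Bool, Resolves x y → Resolves x z → f y = f z

/-- The subcube `C(x)` is colorful for `f` (contains both a 0-point and a 1-point). -/
def Colorful (f : (ι → Bool) → Bool) (x : ι → K) : Prop :=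
  ∃ y z : ι → Bool, Resolves x y ∧ Resolves x z ∧ f y ≠ f z

/-- `C(x)` is a minimal colorful cube for `f`. -/
def MinColorful (f : (ι → Bool) → Bool) (x : ι → K) : Prop :=
  Colorful f x ∧ ∀ i, x i = none →
    (Mono f (Function.update x i (some false)) ∨ Mono f (Function.update x i (some true)))

/-- A Boolean function is non-degenerate if it depends on every input position. -/
def Nondegenerate (f : (ι → Bool) → Bool) : Prop :=
  ∀ i : ι, ∃ x y : ι → Bool, (∀ j, j ≠ i → x j = y j) ∧ x i ≠ y i ∧ f x ≠ f y

/-- The `n`-input AND function. -/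
def ANDf (n : ℕ) (x : Fin n → Bool) : Bool := decide (∀ i, x i = true)

omit [Fintype ι] [DecidableEq ι] in
theorem Below.trans {x y z : ι → K} (hxy : Below x y) (hyz : Below y z) : Below x z := by
  intro i
  rcases hxy i with h | h
  · exact Or.inl h
  · rw [h]
    exact hyz i

omit [Fintype ι] [DecidableEq ι] in
theorem Below.refl (x : ι → K) : Below x x := fun _ => Or.inr rfl

omit [Fintype ι] [DecidableEq ι] in
theorem Below.sumElim {κ : Type} {a a' : ι → K} {z z' : κ → K} (ha : Below a a')
    (hz : Below z z') : Below (Sum.elim a z) (Sum.elim a' z') := by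
  rintro (i | i)
  · exact ha i
  · exact hz i

omit [DecidableEq ι] in
theorem numU_lt_of_strictAbove {x y : ι → K} (h : StrictAbove y x) : numU y < numU x := by
  obtain ⟨hb, hne⟩ := h
  apply Finset.card_lt_card
  rw [Finset.ssubset_iff_of_subset]
  · obtain ⟨i, hi⟩ := Function.ne_iff.mp hne
    have hx : x i = none := (hb i).resolve_right (Ne.symm hi)
    exact ⟨i, by simp [hx], by simpa [hx] using hi⟩
  · intro i hi
    simp only [Finset.mem_filter, Finset.mem_univ, true_and] at hi ⊢
    rcases hb i with h | h
    · exact h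
    · rw [h, hi]

omit [DecidableEq ι] in
/-- Fixing a block of the inputs preserves weak hazard-freeness. -/
theorem WeaklyHF.sumElim {κ : Type} {g : (ι ⊕ κ → K) → K} (hg : WeaklyHF g) (a : ι → K) :
    WeaklyHF (fun z : κ → K => g (Sum.elim a z)) := by
  refine ⟨fun x y h => hg.1 _ _ ((Below.refl a).sumElim h), ?_⟩
  intro z b hz hall
  cases b with
  | none =>
    obtain ⟨y, hy⟩ := hz
    rcases hg.1 _ _ ((Below.refl a).sumElim hy.1) with h | h
    · exact h
    · exact h.trans (hall y hy)
  | some b =>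
    have hup : ∀ a', Below a a' → ∀ y, StrictAbove y z → g (Sum.elim a' y) = some b := by
      intro a' ha y hy
      have hay : g (Sum.elim a y) = some b := hall y hy
      rcases hg.1 _ _ (ha.sumElim (Below.refl y)) with h | h
      · rw [hay] at h
        cases h
      · exact h ▸ hay
    have key : ∀ N, ∀ a', numU a' = N → Below a a' → g (Sum.elim a' z) = some b := by
      intro N
      induction N using Nat.strong_induction_on with
      | _ N ih =>
        intro a' hN ha
        refine hg.2 _ _ ?_ ?_
        · obtain ⟨y, hy⟩ := hz
          refine ⟨Sum.elim a' y, (Below.refl a').sumElim hy.1, fun h => hy.2 ?_⟩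
          funext i
          exact congrFun h (Sum.inr i)
        · rintro y ⟨hy, hne⟩
          have hl : Below a' (y ∘ Sum.inl) := fun i => hy (Sum.inl i)
          have hr : Below z (y ∘ Sum.inr) := fun i => hy (Sum.inr i)
          rw [← Sum.elim_comp_inl_inr y] at hne ⊢
          by_cases hyz : y ∘ Sum.inr = z
          · rw [hyz] at hne ⊢
            have hlt : StrictAbove (y ∘ Sum.inl) a' := ⟨hl, fun h => hne (by rw [h])⟩
            exact ih _ (hN ▸ numU_lt_of_strictAbove hlt) _ rfl (ha.trans hl)
          · exact hup _ (ha.trans hl) _ ⟨hr, hyz⟩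
    exact key _ a rfl (Below.refl a)

omit [DecidableEq ι] in
/-- Certificate complexity at `x` is attained by some certificate. -/
theorem exists_card_eq_ccAt (g : (ι → K) → K) (x : ι → K) :
    ∃ S : Finset ι, S.card = ccAt g x ∧ ∀ y : ι → K, (∀ i ∈ S, y i = x i) → g y = g x :=
  Nat.sInf_mem (s := {k : ℕ | ∃ S : Finset ι, S.card = k ∧
    ∀ y : ι → K, (∀ i ∈ S, y i = x i) → g y = g x})
    ⟨_, Finset.univ, rfl, fun y hy => by rw [funext fun i => hy i (Finset.mem_univ i)]⟩

omit [Fintype ι] [DecidableEq ι] in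
theorem ccAt_le_card {g : (ι → K) → K} {x : ι → K} {S : Finset ι}
    (hS : ∀ y : ι → K, (∀ i ∈ S, y i = x i) → g y = g x) : ccAt g x ≤ S.card :=
  Nat.sInf_le ⟨S, rfl, hS⟩

omit [DecidableEq ι] in
theorem ccAt_le_ccVal (g : (ι → K) → K) {x : ι → K} {b : K} (hx : g x = b) :
    ccAt g x ≤ ccVal g b :=
  le_ciSup (f := fun x : {x : ι → K // g x = b} => ccAt g x.1)
    (Set.finite_range _).bddAbove ⟨x, hx⟩

omit [Fintype ι] [DecidableEq ι] in
theorem ccAt_sumElim_le_card_toRight {κ : Type} {g : (ι ⊕ κ → K) → K} {a : ι → K} {z : κ → K}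
    {S : Finset (ι ⊕ κ)}
    (hS : ∀ y, (∀ i ∈ S, y i = Sum.elim a z i) → g y = g (Sum.elim a z)) :
    ccAt (fun z : κ → K => g (Sum.elim a z)) z ≤ S.toRight.card := by
  refine ccAt_le_card fun y hy => hS _ ?_
  rintro (i | i) hi
  · rfl
  · exact hy i (Finset.mem_toRight.mpr hi)

omit [DecidableEq ι] in
theorem ccVal_sumElim_le {κ : Type} [Fintype κ] (g : (ι ⊕ κ → K) → K)
    (a : ι → K) (b : K) : ccVal (fun z : κ → K => g (Sum.elim a z)) b ≤ ccVal g b := by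
  refine ciSup_le' ?_
  rintro ⟨z, hz⟩
  obtain ⟨S, hcard, hS⟩ := exists_card_eq_ccAt g (Sum.elim a z)
  have h₁ := ccAt_sumElim_le_card_toRight hS
  have h₂ := ccAt_le_ccVal g hz
  have h₃ := S.card_toLeft_add_card_toRight
  dsimp only at h₁ ⊢
  omega

omit [DecidableEq ι] in
/-- Fixing a block of inputs that certifies the all-`u` input lowers the certificate complexity
of each stable value. -/
theorem ccVal_sumElim_le_sub_one {κ : Type} [Fintype κ] {g : (ι ⊕ κ → K) → K}
    (hcert : ∀ y : ι ⊕ κ → K, (∀ i : ι, y (Sum.inl i) = none) → g y = none)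
    (a : ι → K) (b : Bool) :
    ccVal (fun z : κ → K => g (Sum.elim a z)) (some b) ≤ ccVal g (some b) - 1 := by
  refine ciSup_le' ?_
  rintro ⟨z, hz⟩
  obtain ⟨S, hcard, hS⟩ := exists_card_eq_ccAt g (Sum.elim a z)
  have h₁ := ccAt_sumElim_le_card_toRight hS
  have h₂ := ccAt_le_ccVal g hz
  have h₃ := S.card_toLeft_add_card_toRight
  have h₄ : 0 < S.toLeft.card := by
    rw [Finset.card_pos, Finset.nonempty_iff_ne_empty]
    intro hempty
    have hval := hS (Sum.elim (fun _ => none) z) (by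
      rintro (i | i) hi
      · have := Finset.mem_toLeft.mpr hi
        simp [hempty] at this
      · rfl)
    rw [hcert _ fun _ => rfl] at hval
    cases hval.trans hz
  dsimp only at h₁ ⊢
  omega

/-- restrictions of a weakly hazard-free function along a `u`-certificate
consisting of the first `k` coordinates remain weakly hazard-free, with controlled
certificate complexities. -/
theorem weakly_hf_restriction (k m : ℕ) (hk : 1 ≤ k)
    (g : ((Fin k ⊕ Fin m) → K) → K) (hg : WeaklyHF g)
    (hu : g (fun _ => none) = none)
    (hcert : ∀ y : (Fin k ⊕ Fin m) → K, (∀ i : Fin k, y (Sum.inl i) = none) → g y = none)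
    (a : Fin k → K) :
    WeaklyHF (fun z : Fin m → K => g (Sum.elim a z)) ∧
    ccVal (fun z : Fin m → K => g (Sum.elim a z)) none ≤ ccVal g none ∧
    (ccVal (fun z : Fin m → K => g (Sum.elim a z)) (some false) = 0 ∨
      ccVal (fun z : Fin m → K => g (Sum.elim a z)) (some false) ≤ ccVal g (some false) - 1) ∧
    (ccVal (fun z : Fin m → K => g (Sum.elim a z)) (some true) = 0 ∨
      ccVal (fun z : Fin m → K => g (Sum.elim a z)) (some true) ≤ ccVal g (some true) - 1) :=
  ⟨hg.sumElim a, ccVal_sumElim_le g a none, Or.inr (ccVal_sumElim_le_sub_one hcert a false),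
    Or.inr (ccVal_sumElim_le_sub_one hcert a true)⟩

end HF
end

section
/- Let f : {0,1}^n → {0,1} be a Boolean function with hazard-free extension f̃. Then: (i) if f̃ has a 1-input, the maximum of s_u(f̃, x) over x with f̃(x) = 1 is attained at some prime implicant of f; (ii) if f̃ has a 0-input, the maximum of s_u(f̃, x) over x with f̃(x) = 0 is attained at some prime implicate of f; (iii) if f̃ has a u-input, the maximum of s_u(f̃, x) over x with f̃(x) = u is attained at some x having exactly one coordinate equal to u. -/
namespace HF

variable {ι : Type} [Fintype ι] [DecidableEq ι]

omit [Fintype ι] [DecidableEq ι] in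
theorem exists_resolves (y : ι → K) : ∃ x, Resolves y x :=
  ⟨fun i => (y i).getD false, fun i => by cases h : y i <;> simp [h]⟩

theorem hfExt_eq_some_iff (f : (ι → Bool) → Bool) (y : ι → K) (b : Bool) :
    hfExt f y = some b ↔ ∀ x, Resolves y x → f x = b := by
  obtain ⟨x, hx⟩ := exists_resolves y
  unfold hfExt
  split_ifs with h1 h2
  · constructor
    · intro h z hz
      rw [h1 z hz]
      exact Option.some.inj h
    · intro h
      rw [← h x hx, h1 x hx]
  · constructor
    · intro h z hz
      rw [h2 z hz]
      exact Option.some.inj h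
    · intro h
      rw [← h x hx, h2 x hx]
  · cases b <;> simp_all

omit [Fintype ι] in
theorem below_update {x : ι → K} {i : ι} (h : x i = none) (c : K) :
    Below x (Function.update x i c) := by
  intro j
  by_cases hj : j = i
  · subst hj
    exact Or.inl h
  · simp [hj]

omit [Fintype ι] [DecidableEq ι] in
theorem Below.resolves {x y : ι → K} (h : Below x y) {z : ι → Bool} (hz : Resolves y z) :
    Resolves x z := by
  intro i
  rcases h i with hi | hi
  · exact Or.inl hi
  · rw [hi]
    exact hz i

theorem Below.hfExt_eq_some {f : (ι → Bool) → Bool} {x y : ι → K} (h : Below x y) {b : Bool}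
    (hx : hfExt f x = some b) : hfExt f y = some b := by
  rw [hfExt_eq_some_iff] at hx ⊢
  exact fun z hz => hx z (h.resolves hz)

omit [DecidableEq ι] in
theorem numU_lt_of_strictBelow {x y : ι → K} (h : StrictBelow x y) : numU y < numU x := by
  obtain ⟨h, hne⟩ := h
  obtain ⟨i, hi⟩ := Function.ne_iff.mp hne
  have hxi : x i = none := (h i).resolve_right hi
  refine Finset.card_lt_card (Finset.ssubset_iff_of_subset ?_ |>.mpr ⟨i, ?_, ?_⟩)
  · intro j hj
    simp only [Finset.mem_filter, Finset.mem_univ, true_and] at hj ⊢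
    rcases h j with hj' | hj'
    · exact hj'
    · rw [hj', hj]
  · simpa using hxi
  · simpa [hxi, eq_comm] using hi

/-- Below every input of stable value `b` there is a minimal one. -/
theorem exists_minimal_below {f : (ι → Bool) → Bool} {x : ι → K} {b : Bool}
    (hx : hfExt f x = some b) :
    ∃ p, Below p x ∧ hfExt f p = some b ∧ ∀ q, StrictBelow q p → hfExt f q ≠ some b := by
  obtain ⟨p, ⟨hpx, hp⟩, hmax⟩ := Set.exists_max_image
    {p : ι → K | Below p x ∧ hfExt f p = some b} numU (Set.toFinite _)
    ⟨x, fun _ => Or.inr rfl, hx⟩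
  exact ⟨p, hpx, hp, fun q hq hqb =>
    (numU_lt_of_strictBelow hq).not_ge (hmax q ⟨hq.1.trans hpx, hqb⟩)⟩

theorem Below.sensAt_le_of_eq_some {f : (ι → Bool) → Bool} {p x : ι → K} (h : Below p x)
    {b : Bool} (hp : hfExt f p = some b) : sensAt (hfExt f) x ≤ sensAt (hfExt f) p := by
  refine Set.ncard_le_ncard ?_ (Set.toFinite _)
  rintro i ⟨y, -, hyj, hfy⟩
  rw [h.hfExt_eq_some hp] at hfy
  have hbelow : Below (Function.update p i none) y := by
    intro j
    by_cases hj : j = i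
    · subst hj
      simp
    · rw [Function.update_of_ne hj, hyj j hj]
      exact h j
  have hne : hfExt f (Function.update p i none) ≠ some b :=
    fun hb => hfy (hbelow.hfExt_eq_some hb)
  refine ⟨Function.update p i none, fun hi => hne ?_, fun j hj => Function.update_of_ne hj _ _, ?_⟩
  · rw [Function.update_self] at hi
    rwa [hi, Function.update_eq_self]
  · rwa [hp]

theorem Below.sensAt_le_of_eq_none {f : (ι → Bool) → Bool} {x y : ι → K} (h : Below x y)
    (hy : hfExt f y = none) : sensAt (hfExt f) x ≤ sensAt (hfExt f) y := by
  have hx : hfExt f x = none := by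
    by_contra hne
    obtain ⟨b, hb⟩ := Option.ne_none_iff_exists'.mp hne
    simp [h.hfExt_eq_some hb] at hy
  refine Set.ncard_le_ncard ?_ (Set.toFinite _)
  rintro i ⟨z, -, hzj, hfz⟩
  rw [hx] at hfz
  obtain ⟨b, hb⟩ := Option.ne_none_iff_exists'.mp hfz
  have hbelow : Below z (Function.update y i (z i)) := by
    intro j
    by_cases hj : j = i
    · subst hj
      simp
    · rw [Function.update_of_ne hj, hzj j hj]
      exact h j
  have hfy := hbelow.hfExt_eq_some hb
  refine ⟨Function.update y i (z i), fun hi => ?_, fun j hj => Function.update_of_ne hj _ _, ?_⟩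
  · rw [Function.update_self] at hi
    rw [hi, Function.update_eq_self, hy] at hfy
    simp at hfy
  · simp [hfy, hy]

theorem hfExt_eq_some_of_update {f : (ι → Bool) → Bool} {y : ι → K} {i : ι} {b : Bool}
    (h : ∀ c : Bool, hfExt f (Function.update y i (some c)) = some b) : hfExt f y = some b := by
  rw [hfExt_eq_some_iff]
  intro x hx
  refine (hfExt_eq_some_iff f _ b).mp (h (x i)) x fun j => ?_
  by_cases hj : j = i
  · subst hj
    simp
  · rw [Function.update_of_ne hj]
    exact hx j

/-- Above every `u`-input there is a `u`-input with a single unstable coordinate. -/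
theorem exists_above_numU_eq_one {f : (ι → Bool) → Bool} {x : ι → K} (hx : hfExt f x = none) :
    ∃ y, Below x y ∧ hfExt f y = none ∧ numU y = 1 := by
  obtain ⟨y, ⟨hxy, hy⟩, hmin⟩ := Set.exists_min_image
    {y : ι → K | Below x y ∧ hfExt f y = none} numU (Set.toFinite _)
    ⟨x, fun _ => Or.inr rfl, hx⟩
  have hstable : ∀ i, y i = none → ∀ c : Bool,
      ∃ b, hfExt f (Function.update y i (some c)) = some b := by
    intro i hi c
    refine Option.ne_none_iff_exists'.mp fun hnone => ?_
    have hbelow := below_update hi (some c)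
    refine (numU_lt_of_strictBelow ⟨hbelow, fun he => ?_⟩).not_ge
      (hmin _ ⟨hxy.trans hbelow, hnone⟩)
    simpa [hi] using congrFun he i
  refine ⟨y, hxy, hy, le_antisymm ?_ (Nat.one_le_iff_ne_zero.mpr fun h0 => ?_)⟩
  · refine Finset.card_le_one.mpr fun i hi j hj => ?_
    simp only [Finset.mem_filter, Finset.mem_univ, true_and] at hi hj
    by_contra hij
    obtain ⟨b, hb⟩ := hstable j hj false
    have key : ∀ c : Bool, hfExt f (Function.update y i (some c)) = some b := by
      intro c
      obtain ⟨d, hd⟩ := hstable i hi c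
      have h1 := (below_update (x := Function.update y i (some c)) (i := j)
        (by rwa [Function.update_of_ne (Ne.symm hij)]) (some false)).hfExt_eq_some hd
      have h2 := (below_update (x := Function.update y j (some false)) (i := i)
        (by rwa [Function.update_of_ne hij]) (some c)).hfExt_eq_some hb
      rw [Function.update_comm hij, h2] at h1
      rw [hd, h1]
    simp [hfExt_eq_some_of_update key] at hy
  · have hne : ∀ i, y i ≠ none := by simpa [numU, Finset.filter_eq_empty_iff] using h0
    obtain ⟨z, hz⟩ := exists_resolves y
    have : hfExt f y = some (f z) := by
      rw [hfExt_eq_some_iff]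
      intro w hw
      congr 1
      funext i
      exact Option.some.inj
        (((hw i).resolve_left (hne i)).symm.trans ((hz i).resolve_left (hne i)))
    simp [this] at hy

theorem exists_prime_sensAt_max {f : (ι → Bool) → Bool} {b : Bool}
    (h : ∃ x, hfExt f x = some b) :
    ∃ p, (hfExt f p = some b ∧ ∀ q, StrictBelow q p → hfExt f q ≠ some b) ∧
      ∀ x, hfExt f x = some b → sensAt (hfExt f) x ≤ sensAt (hfExt f) p := by
  obtain ⟨x, hx, hmax⟩ := Set.exists_max_image {x : ι → K | hfExt f x = some b}
    (sensAt (hfExt f)) (Set.toFinite _) h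
  obtain ⟨p, hpx, hp, hprime⟩ := exists_minimal_below hx
  exact ⟨p, ⟨hp, hprime⟩, fun z hz => (hmax z hz).trans (hpx.sensAt_le_of_eq_some hp)⟩

/-- maximum hazard-free sensitivity over 1-inputs is attained at a prime
implicant, over 0-inputs at a prime implicate, and over u-inputs at a point with
exactly one `u` coordinate. -/
theorem sens_maximizers (n : ℕ) (f : (Fin n → Bool) → Bool) :
    ((∃ x, hfExt f x = some true) → ∃ p : Fin n → K, PrimeImplicant f p ∧
      ∀ x, hfExt f x = some true → sensAt (hfExt f) x ≤ sensAt (hfExt f) p) ∧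
    ((∃ x, hfExt f x = some false) → ∃ p : Fin n → K, PrimeImplicate f p ∧
      ∀ x, hfExt f x = some false → sensAt (hfExt f) x ≤ sensAt (hfExt f) p) ∧
    ((∃ x, hfExt f x = none) → ∃ p : Fin n → K, hfExt f p = none ∧ numU p = 1 ∧
      ∀ x, hfExt f x = none → sensAt (hfExt f) x ≤ sensAt (hfExt f) p) := by
  refine ⟨exists_prime_sensAt_max, exists_prime_sensAt_max, fun h => ?_⟩
  obtain ⟨x, hx, hmax⟩ := Set.exists_max_image {x : Fin n → K | hfExt f x = none}
    (sensAt (hfExt f)) (Set.toFinite _) h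
  obtain ⟨y, hxy, hy, hone⟩ := exists_above_numU_eq_one hx
  exact ⟨y, hy, hone, fun z hz => (hmax z hz).trans (hxy.sensAt_le_of_eq_none hy)⟩

end HF
end
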